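/- arXiv:math/0601578 — 6 statements merged into one kernel-verified Lean document; each statement's English description precedes it below -/
import Mathlib

section
/- Let k be a field, G a finite group, and w a finite-dimensional kG-module. Let x and y be finite-dimensional kG-modules neither of which has a nonzero w-projective direct summand, and let α : x → y be a kG-module homomorphism. If there exists a kG-module homomorphism β : y → x such that both β∘α − id_x and α∘β − id_y factor through w-projective kG-modules, then α is an isomorphism of kG-modules. -/
open CategoryTheory MonoidalCategory TensorProduct

/-- A representation `P` is `w`-projective if it is a direct summand of `w ⊗ N`
(diagonal action) for some representation `N`. -/
def IsRelProj {k G : Type} [Field k] [Group G] (w P : Rep k G) : Prop :=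
  ∃ (N : Rep k G) (i : P ⟶ w ⊗ N) (r : w ⊗ N ⟶ P), i ≫ r = 𝟙 P

/-- A `k`-linear map `f` between carriers of representations (with actions `actA`, `actB`)
factors through a `w`-projective module via equivariant maps. -/
def FactorsThroughRelProj {k G : Type} [Field k] [Group G] (w : Rep k G)
    {A B : Type} [AddCommGroup A] [Module k A] [AddCommGroup B] [Module k B]
    (actA : G → A →ₗ[k] A) (actB : G → B →ₗ[k] B) (f : A →ₗ[k] B) : Prop :=
  ∃ (P : Rep k G), IsRelProj w P ∧
    ∃ (u : A →ₗ[k] P) (v : P →ₗ[k] B),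
      (∀ (g : G) (a : A), u (actA g a) = P.ρ g (u a)) ∧
      (∀ (g : G) (p : P), v (P.ρ g p) = actB g (v p)) ∧
      f = v ∘ₗ u

/-- A retract of a `w`-projective representation is `w`-projective. -/
theorem IsRelProj.of_retract {k G : Type} [Field k] [Group G] {w P Q : Rep k G}
    (hP : IsRelProj w P) (i : Q ⟶ P) (r : P ⟶ Q) (h : i ≫ r = 𝟙 Q) : IsRelProj w Q := by
  obtain ⟨N, j, s, hjs⟩ := hP
  refine ⟨N, i ≫ j, s ≫ r, ?_⟩
  rw [Category.assoc, ← Category.assoc j, hjs, Category.id_comp, h]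

/-- If a finite-dimensional representation has no nonzero `w`-projective direct summand, then
every equivariant endomorphism factoring through a `w`-projective representation is nilpotent. -/
theorem isNilpotent_of_factorsThroughRelProj {k G : Type} [Field k] [Group G] {w : Rep k G}
    {X : Type} [AddCommGroup X] [Module k X] [FiniteDimensional k X]
    {ρ : Representation k G X}
    (hX : ∀ (P : Rep k G), IsRelProj w P →
      (∃ (i : P →ₗ[k] X) (r : X →ₗ[k] P),
        (∀ (g : G) (p : P), i (P.ρ g p) = ρ g (i p)) ∧
        (∀ (g : G) (a : X), r (ρ g a) = P.ρ g (r a)) ∧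
        r ∘ₗ i = LinearMap.id) → Subsingleton P)
    {e : Module.End k X}
    (h : FactorsThroughRelProj w (fun g => ρ g) (fun g => ρ g) e) : IsNilpotent e := by
  obtain ⟨P, hP, u, v, hu, hv, huv⟩ := h
  have he (g : G) : Commute e (ρ g) := by
    ext x
    simp [huv, hu, hv]
  have hpow (n : ℕ) (g : G) (x : X) : (e ^ n) (ρ g x) = ρ g ((e ^ n) x) :=
    LinearMap.congr_fun ((he g).pow_left n).eq x
  obtain ⟨n, hn⟩ := e.eventually_isCompl_ker_pow_range_pow.exists_forall_of_atTop
  have hker := LinearMap.disjoint_ker.mp (hn (n + 1) n.le_succ).disjoint.symm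
  set R := LinearMap.range (e ^ (n + 1))
  have hinv (g : G) : R ≤ R.comap (ρ g) := by
    rintro _ ⟨x, rfl⟩
    exact ⟨ρ g x, hpow _ _ _⟩
  let q : X →ₗ[k] R := (e ^ (n + 1)).rangeRestrict
  let σ : Representation k G R := ρ.subrepresentation R hinv
  have hq (g : G) (x : X) : q (ρ g x) = σ g (q x) := Subtype.ext (hpow _ _ _)
  have hinj : Function.Injective (q ∘ₗ R.subtype) := by
    rw [← LinearMap.ker_eq_bot, LinearMap.ker_eq_bot']
    intro x hx
    exact Subtype.ext (hker x x.2 (congrArg Subtype.val hx))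
  let T : R ≃ₗ[k] R := LinearEquiv.ofInjectiveEndo (q ∘ₗ R.subtype) hinj
  have hT_apply (x : R) : T x = q x := rfl
  have hT (g : G) (x : R) : T.symm (σ g x) = σ g (T.symm x) := by
    rw [LinearEquiv.symm_apply_eq, hT_apply]
    change _ = q (ρ g (T.symm x))
    rw [hq, ← hT_apply, T.apply_symm_apply]
  have hqe (x : R) : q ((e ^ n) (v (u x))) = T (T x) := by
    rw [hT_apply, hT_apply]
    congr 1
    change _ = (e ^ (n + 1)) x
    rw [pow_succ, Module.End.mul_apply]
    simp [huv]
  have hproj : IsRelProj w (Rep.of σ) := by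
    let i : σ.IntertwiningMap P.ρ :=
      (u ∘ₗ R.subtype).intertwiningMap_of_isIntertwiningMap σ P.ρ fun g x => hu g x
    let r : P.ρ.IntertwiningMap σ :=
      (T.symm.toLinearMap ∘ₗ T.symm.toLinearMap ∘ₗ q ∘ₗ (e ^ n) ∘ₗ v)
        |>.intertwiningMap_of_isIntertwiningMap P.ρ σ fun g p => by
          simp [hv, hpow, hq, hT]
    refine hP.of_retract (Rep.ofHom i) (Rep.ofHom r) ?_
    ext x
    change ((T.symm (T.symm (q ((e ^ n) (v (u x))))) : R) : X) = x
    simp [hqe]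
  have hsub : Subsingleton R := hX (Rep.of σ) hproj
    ⟨R.subtype, T.symm.toLinearMap ∘ₗ q, fun _ _ => rfl, fun g x => by
      change T.symm (q (ρ g x)) = σ g (T.symm (q x))
      rw [hq, hT], by
      ext x
      change ((T.symm (q x) : R) : X) = x
      rw [← hT_apply, T.symm_apply_apply]⟩
  refine ⟨n + 1, LinearMap.range_eq_bot.mp ?_⟩
  exact Submodule.subsingleton_iff_eq_bot.mp hsub

/-- An endomorphism that differs from the identity by a nilpotent one is bijective. -/
theorem Module.End.bijective_of_isNilpotent_sub_id {k X : Type*} [Ring k] [AddCommGroup X]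
    [Module k X] {f : Module.End k X} (h : IsNilpotent (f - LinearMap.id)) :
    Function.Bijective f := by
  rw [← Module.End.isUnit_iff]
  have := h.isUnit_add_one
  rwa [Module.End.one_eq_id, sub_add_cancel] at this

/-- if `α : x → y` is a `kG`-map between finite-dimensional modules without
nonzero `w`-projective direct summands which is invertible modulo `w`-projectives, then
`α` is an isomorphism of `kG`-modules. -/
theorem stmt_1 (k G : Type) [Field k] [Group G] [Finite G]
    (w : Rep k G) (hw : FiniteDimensional k w)
    (X Y : Type) [AddCommGroup X] [Module k X] [AddCommGroup Y] [Module k Y]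
    [FiniteDimensional k X] [FiniteDimensional k Y]
    (ρx : Representation k G X) (ρy : Representation k G Y)
    (hX : ∀ (P : Rep k G), IsRelProj w P →
      (∃ (i : P →ₗ[k] X) (r : X →ₗ[k] P),
        (∀ (g : G) (p : P), i (P.ρ g p) = ρx g (i p)) ∧
        (∀ (g : G) (a : X), r (ρx g a) = P.ρ g (r a)) ∧
        r ∘ₗ i = LinearMap.id) → Subsingleton P)
    (hY : ∀ (P : Rep k G), IsRelProj w P →
      (∃ (i : P →ₗ[k] Y) (r : Y →ₗ[k] P),
        (∀ (g : G) (p : P), i (P.ρ g p) = ρy g (i p)) ∧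
        (∀ (g : G) (a : Y), r (ρy g a) = P.ρ g (r a)) ∧
        r ∘ₗ i = LinearMap.id) → Subsingleton P)
    (α : X →ₗ[k] Y) (hα : ∀ (g : G) (a : X), α (ρx g a) = ρy g (α a))
    (hinv : ∃ β : Y →ₗ[k] X, (∀ (g : G) (b : Y), β (ρy g b) = ρx g (β b)) ∧
      FactorsThroughRelProj w (fun g => ρx g) (fun g => ρx g) (β ∘ₗ α - LinearMap.id) ∧
      FactorsThroughRelProj w (fun g => ρy g) (fun g => ρy g) (α ∘ₗ β - LinearMap.id)) :
    Function.Bijective α := by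
  obtain ⟨β, -, hβα, hαβ⟩ := hinv
  have h₁ : Function.Bijective (β ∘ₗ α) :=
    Module.End.bijective_of_isNilpotent_sub_id (isNilpotent_of_factorsThroughRelProj hX hβα)
  have h₂ : Function.Bijective (α ∘ₗ β) :=
    Module.End.bijective_of_isNilpotent_sub_id (isNilpotent_of_factorsThroughRelProj hY hαβ)
  rw [LinearMap.coe_comp] at h₁ h₂
  exact ⟨h₁.injective.of_comp, h₂.surjective.of_comp⟩
end

section
/- Let k be a field of characteristic p > 0 dividing the order of a finite group G, and let X be a kG-module with no nonzero projective direct summand. Suppose X is stably compact, i.e.: for every family (Y_i)_{i ∈ I} of kG-modules and every kG-homomorphism f : X → ⊕_{i∈I} Y_i there exist a finite subset F ⊆ I and a kG-homomorphism g : X → ⊕_{i∈F} Y_i such that f − (inclusion ∘ g) factors through a projective kG-module. Then X is finite-dimensional over k. -/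
open DirectSum

/-- A map of `A`-modules factors through a projective `A`-module. -/
def FactorsThroughProjective (A : Type) [Ring A] {X Y : Type}
    [AddCommGroup X] [Module A X] [AddCommGroup Y] [Module A Y]
    (f : X →ₗ[A] Y) : Prop :=
  ∃ (P : ModuleCat.{0} A), Module.Projective A P ∧
    ∃ (u : X →ₗ[A] P) (v : P →ₗ[A] Y), f = v ∘ₗ u

/-- A simple module over an Artinian ring has a projective cover: a projective module `P` with a
surjection `π` onto `S` such that every endomorphism of `P` over `S` is bijective. -/
theorem IsSimpleModule.exists_projective_cover (A : Type*) [Ring A] [IsArtinianRing A]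
    (S : Type*) [AddCommGroup S] [Module A S] [IsSimpleModule A S] :
    ∃ (P : Submodule A A) (π : P →ₗ[A] S), Module.Projective A P ∧ Function.Surjective π ∧
      ∀ φ : Module.End A P, π ∘ₗ φ = π → Function.Bijective φ := by
  obtain ⟨s, hs⟩ := @exists_ne S (IsSimpleModule.nontrivial A S) 0
  let π := LinearMap.toSpanSingleton A S s
  have hπ : Function.Surjective π := IsSimpleModule.toSpanSingleton_surjective A hs
  obtain ⟨P, ⟨hproj, hsurj⟩, hmin⟩ := (wellFounded_lt (α := Submodule A A)).has_min
    {P | Module.Projective A P ∧ Function.Surjective (π ∘ₗ P.subtype)}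
    ⟨⊤, .of_equiv Submodule.topEquiv.symm, fun y ↦ by
      obtain ⟨x, rfl⟩ := hπ y
      exact ⟨⟨x, trivial⟩, rfl⟩⟩
  refine ⟨P, π ∘ₗ P.subtype, hproj, hsurj, fun φ hφ ↦ ?_⟩
  have hpow : ∀ (n : ℕ) (x : P), π ((φ ^ n) x : P) = π x := by
    intro n
    induction n with
    | zero => simp
    | succ n ih =>
      intro x
      rw [pow_succ', Module.End.mul_apply]
      exact (LinearMap.congr_fun hφ _).trans (ih x)
  obtain ⟨n, hcompl, hn⟩ := (φ.eventually_isCompl_ker_pow_range_pow.and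
    (Filter.eventually_ge_atTop 1)).exists
  set R := LinearMap.range (φ ^ n)
  have hR : Module.Projective A R := by
    refine .of_split R.subtype (Submodule.projectionOnto R _ hcompl.symm) ?_
    ext x
    simp [Submodule.projectionOnto_apply_left]
  have htop : R = ⊤ := by
    let e : R ≃ₗ[A] R.map P.subtype := Submodule.equivSubtypeMap P R
    by_contra hne
    refine hmin (R.map P.subtype) ⟨.of_equiv e, fun y ↦ ?_⟩ (lt_of_le_of_ne ?_ fun h ↦ hne ?_)
    · obtain ⟨x, rfl⟩ := hsurj y
      exact ⟨⟨((φ ^ n) x : P), Submodule.mem_map_of_mem ⟨x, rfl⟩⟩, hpow n x⟩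
    · exact Submodule.map_subtype_le P R
    · apply Submodule.map_injective_of_injective P.subtype_injective
      rw [h, Submodule.map_subtype_top]
  have hφsurj : Function.Surjective φ := by
    intro y
    obtain ⟨x, hx⟩ : y ∈ R := htop ▸ trivial
    obtain ⟨m, rfl⟩ := Nat.exists_eq_add_of_le' hn
    rw [pow_succ', Module.End.mul_apply] at hx
    exact ⟨_, hx⟩
  exact IsNoetherian.bijective_of_surjective_endomorphism φ hφsurj

/-- Over an Artinian ring, a module mapping onto a simple module through a projective module has
a nonzero projective direct summand. -/
theorem Module.exists_projective_isCompl_of_surjective {A : Type*} [Ring A] [IsArtinianRing A]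
    {X P S : Type*} [AddCommGroup X] [Module A X] [AddCommGroup P] [Module A P]
    [Module.Projective A P] [AddCommGroup S] [Module A S] [IsSimpleModule A S]
    (u : X →ₗ[A] P) (v : P →ₗ[A] S) (h : Function.Surjective (v ∘ₗ u)) :
    ∃ Q : Submodule A X, (∃ Q', IsCompl Q Q') ∧ Module.Projective A Q ∧ Q ≠ ⊥ := by
  obtain ⟨C, π, hC, hπ, hbij⟩ := IsSimpleModule.exists_projective_cover A S
  obtain ⟨α, hα⟩ := Module.projective_lifting_property (v ∘ₗ u) π h
  obtain ⟨β, hβ⟩ := Module.projective_lifting_property π v hπ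
  have hφ : Function.Bijective ((β ∘ₗ u) ∘ₗ α) := hbij _ <| by
    rw [← LinearMap.comp_assoc, ← LinearMap.comp_assoc, hβ, hα]
  have hinj : Function.Injective α :=
    Function.Injective.of_comp (f := β ∘ₗ u) hφ.1
  refine ⟨LinearMap.range α, ⟨LinearMap.ker (β ∘ₗ u), ?_⟩,
    .of_equiv (LinearEquiv.ofInjective α hinj), fun hbot ↦ ?_⟩
  · refine isCompl_iff.2 ⟨Submodule.disjoint_def.2 ?_, codisjoint_iff.2 <| eq_top_iff.2 ?_⟩
    · rintro _ ⟨c, rfl⟩ hc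
      have : c = 0 := hφ.1 (by simpa using hc)
      rw [this, map_zero]
    · intro x _
      obtain ⟨c, hc⟩ := hφ.2 ((β ∘ₗ u) x)
      refine Submodule.mem_sup.2 ⟨α c, ⟨c, rfl⟩, x - α c, ?_, add_sub_cancel _ _⟩
      rw [LinearMap.mem_ker, map_sub, sub_eq_zero]
      exact hc.symm
  · have := IsSimpleModule.nontrivial A S
    obtain ⟨s, hs⟩ := exists_ne (0 : S)
    obtain ⟨c, rfl⟩ := hπ s
    rw [LinearMap.range_eq_bot] at hbot
    exact hs (by rw [← hα, hbot]; simp)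

theorem IsSemiprimaryRing.isSemisimpleModule_quotient_jacobson_smul_top (A X : Type*) [Ring A]
    [IsSemiprimaryRing A] [AddCommGroup X] [Module A X] :
    IsSemisimpleModule A (X ⧸ (Ring.jacobson A • ⊤ : Submodule A X)) := by
  have h : Module.IsTorsionBySet A (X ⧸ (Ring.jacobson A • ⊤ : Submodule A X))
      (Ring.jacobson A) := by
    rw [Module.isTorsionBySet_quotient_iff]
    exact fun m i hi ↦ Submodule.smul_mem_smul hi trivial
  let _ := h.module
  exact (h.semilinearMap.isSemisimpleModule_iff_of_bijective Function.bijective_id).2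
    inferInstance

/-- Nakayama's lemma for arbitrary modules over a semiprimary ring. -/
theorem IsSemiprimaryRing.finite_of_finite_quotient (A X : Type*) [Ring A]
    [IsSemiprimaryRing A] [AddCommGroup X] [Module A X]
    [Module.Finite A (X ⧸ (Ring.jacobson A • ⊤ : Submodule A X))] : Module.Finite A X := by
  set J := Ring.jacobson A
  obtain ⟨N, hN, hmap⟩ : ∃ N : Submodule A X, N.FG ∧ N.map (J • ⊤ : Submodule A X).mkQ = ⊤ := by
    obtain ⟨n, f, hf⟩ := Module.Finite.exists_fin' A (X ⧸ (J • ⊤ : Submodule A X))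
    obtain ⟨g, hg⟩ := Module.projective_lifting_property (J • ⊤ : Submodule A X).mkQ f
      (Submodule.mkQ_surjective _)
    exact ⟨LinearMap.range g, Submodule.fg_range g,
      by rw [← LinearMap.range_comp, hg, LinearMap.range_eq_top.2 hf]⟩
  have hsup : J • ⊤ ⊔ N = ⊤ := by
    rw [← Submodule.comap_map_mkQ, hmap, Submodule.comap_top]
  have hpow (n : ℕ) : J ^ n • ⊤ ⊔ N = ⊤ := by
    induction n with
    | zero => simp [Submodule.pow_zero]
    | succ n ih =>
      refine eq_top_iff.2 (ih.ge.trans (sup_le ?_ le_sup_right))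
      conv_lhs => rw [← hsup, Submodule.smul_sup, ← Submodule.mul_smul, ← Submodule.pow_succ]
      exact sup_le_sup_left Submodule.smul_le_right _
  obtain ⟨n, hn⟩ := IsSemiprimaryRing.isNilpotent (R := A)
  have htop : N = ⊤ := by simpa [J, hn] using hpow n
  exact ⟨htop ▸ hN⟩

/-- a stably compact `kG`-module with no nonzero projective direct summand
is finite dimensional over `k`. -/
theorem stmt_2 (k G : Type) [Field k] [Group G] [Fintype G]
    (p : ℕ) (hp : p.Prime) [CharP k p] (hdvd : p ∣ Fintype.card G)
    (X : Type) [AddCommGroup X] [Module k X] [Module (MonoidAlgebra k G) X]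
    [IsScalarTower k (MonoidAlgebra k G) X]
    (hX : ∀ P : Submodule (MonoidAlgebra k G) X, (∃ Q, IsCompl P Q) →
      Module.Projective (MonoidAlgebra k G) P → P = ⊥)
    (hcpt : ∀ (I : Type) (Y : I → ModuleCat.{0} (MonoidAlgebra k G))
      (f : X →ₗ[MonoidAlgebra k G] ⨁ i, Y i),
      ∃ (F : Finset I) (g : X →ₗ[MonoidAlgebra k G] ⨁ i, Y i),
        (∀ i ∉ F, ∀ a : X, g a i = 0) ∧
        FactorsThroughProjective (MonoidAlgebra k G) (f - g)) :
    FiniteDimensional k X := by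
  have : IsArtinianRing (MonoidAlgebra k G) := IsArtinianRing.of_finite k _
  set A := MonoidAlgebra k G
  let T := X ⧸ (Ring.jacobson A • ⊤ : Submodule A X)
  have : IsSemisimpleModule A T :=
    IsSemiprimaryRing.isSemisimpleModule_quotient_jacobson_smul_top A X
  obtain ⟨s, e, -, hs⟩ := IsSemisimpleModule.exists_linearEquiv_dfinsupp A T
  let f : X →ₗ[A] ⨁ m : s, ModuleCat.of A m.1 :=
    e.toLinearMap ∘ₗ (Ring.jacobson A • ⊤ : Submodule A X).mkQ
  have hf : Function.Surjective f := e.surjective.comp (Submodule.mkQ_surjective _)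
  obtain ⟨F, g, hg, P, hP, u, v, huv⟩ := hcpt s (fun m ↦ ModuleCat.of A m.1) f
  have hF (m : s) : m ∈ F := by
    by_contra hm
    have := hs m
    let c := DirectSum.component A s (fun m ↦ ModuleCat.of A m.1) m
    have hcomp : (c ∘ₗ v) ∘ₗ u = c ∘ₗ f := by
      rw [LinearMap.comp_assoc, ← huv]
      refine LinearMap.ext fun x ↦ ?_
      rw [LinearMap.comp_apply, LinearMap.comp_apply, LinearMap.sub_apply, map_sub]
      exact sub_eq_self.2 (hg m hm x)
    have hc : Function.Surjective c := fun y ↦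
      ⟨DirectSum.lof A s (fun m ↦ ModuleCat.of A m.1) m y,
        DirectSum.component.lof_self (M := fun m : s ↦ ModuleCat.of A m.1) A m y⟩
    obtain ⟨Q, hQ, hQproj, hne⟩ := Module.exists_projective_isCompl_of_surjective
      (S := m.1) u (c ∘ₗ v) (hcomp ▸ hc.comp hf)
    exact hne (hX Q hQ hQproj)
  have : Finite s := Finite.of_injective (fun m ↦ (⟨m, hF m⟩ : F)) fun _ _ h ↦ by simpa using h
  have : Fintype s := Fintype.ofFinite s
  have (m : s) : Module.Finite A m.1 := have := hs m; inferInstance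
  have : Module.Finite A T := .equiv
    (e.trans (DirectSum.linearEquivFunOnFintype A s fun m ↦ m.1)).symm
  have : Module.Finite A X := IsSemiprimaryRing.finite_of_finite_quotient A X
  exact Module.Finite.trans A X
end

section
/- Let k be a field of characteristic p > 0 dividing the order of a finite group G, and let X be a kG-module. If every kG-module homomorphism from every finite-dimensional kG-module into X factors through a projective kG-module, then X is a projective kG-module. -/
open MonoidAlgebra TensorProduct

namespace MonoidAlgebra

section

variable (k G V : Type*) [Field k] [Group G] [AddCommGroup V] [Module k V]

/-- The `k`-linear map `k[G] ⊗ V → V` sending `a ⊗ v` to the coefficient of `a` at `1` times `v`. -/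
noncomputable def coeffOneTensor : k[G] ⊗[k] V →ₗ[k] V :=
  TensorProduct.lift <| LinearMap.lsmul k V ∘ₗ
    { toFun := fun a => a.coeff 1
      map_add' := fun a b => by simp
      map_smul' := fun c a => by simp }

variable {k G V}

@[simp]
theorem coeffOneTensor_tmul (a : k[G]) (v : V) :
    coeffOneTensor k G V (a ⊗ₜ v) = a.coeff 1 • v := rfl

end

variable {k G V : Type*} [Field k] [Group G] [Fintype G]
  [AddCommGroup V] [Module k V] [Module k[G] V] [IsScalarTower k k[G] V]

theorem sumOfConjugatesEquivariant_coeffOneTensor_one_tmul (v : V) :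
    (coeffOneTensor k G V).sumOfConjugatesEquivariant G (1 ⊗ₜ v) = v := by
  classical
  rw [LinearMap.sumOfConjugatesEquivariant_apply, Finset.sum_eq_single 1]
  · simp [LinearMap.conjugate_apply, ← one_def]
  · intro g _ hg
    simp [LinearMap.conjugate_apply, smul_tmul', hg]
  · simp

theorem coeffOneTensor_sumOfConjugatesEquivariant_mk (v : V) :
    coeffOneTensor k G V
      ((TensorProduct.mk k k[G] V 1).sumOfConjugatesEquivariant G v) = v := by
  classical
  rw [LinearMap.sumOfConjugatesEquivariant_apply, map_sum, Finset.sum_eq_single 1]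
  · simp [LinearMap.conjugate_apply, ← one_def]
  · intro g _ hg
    simp [LinearMap.conjugate_apply, smul_tmul', hg]
  · simp

/-- The identity of a projective `k[G]`-module is the trace of a `k`-linear endomorphism. -/
theorem exists_sumOfConjugatesEquivariant_eq_id [Module.Projective k[G] V] :
    ∃ θ : V →ₗ[k] V, θ.sumOfConjugatesEquivariant G = LinearMap.id := by
  obtain ⟨s, hs⟩ := Module.projective_lifting_property
    ((coeffOneTensor k G V).sumOfConjugatesEquivariant G) LinearMap.id
    fun v => ⟨1 ⊗ₜ v, sumOfConjugatesEquivariant_coeffOneTensor_one_tmul v⟩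
  refine ⟨coeffOneTensor k G V ∘ₗ s.restrictScalars k, ?_⟩
  rw [← hs]
  ext v
  simp [LinearMap.sumOfConjugatesEquivariant_apply, LinearMap.conjugate_apply]

/-- A projective module over the group algebra of a finite group satisfies Baer's criterion. -/
theorem baer_of_projective [Module.Projective k[G] V] : Module.Baer k[G] V := by
  intro I f
  obtain ⟨θ, hθ⟩ := exists_sumOfConjugatesEquivariant_eq_id (k := k) (G := G) (V := V)
  obtain ⟨F, hF⟩ := LinearMap.exists_extend (p := I.restrictScalars k) (f.restrictScalars k)
  have hF' (x : k[G]) (hx : x ∈ I) : F x = f ⟨x, hx⟩ := LinearMap.congr_fun hF ⟨x, hx⟩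
  refine ⟨(θ ∘ₗ F).sumOfConjugatesEquivariant G, fun x hx => ?_⟩
  rw [← LinearMap.id_apply (R := k[G]) (f ⟨x, hx⟩), ← hθ]
  simp only [LinearMap.sumOfConjugatesEquivariant_apply, LinearMap.conjugate_apply,
    LinearMap.comp_apply]
  refine Finset.sum_congr rfl fun g _ => ?_
  rw [smul_eq_mul, hF' _ (I.mul_mem_left _ hx), ← f.map_smul]
  rfl

/-- A module over the group algebra of a finite group satisfying Baer's criterion is projective. -/
theorem projective_of_baer (h : Module.Baer k[G] V) : Module.Projective k[G] V := by
  let i := (TensorProduct.mk k k[G] V 1).sumOfConjugatesEquivariant G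
  have hi : Function.Injective i :=
    Function.LeftInverse.injective coeffOneTensor_sumOfConjugatesEquivariant_mk
  obtain ⟨r, hr⟩ := h.extension_property i hi LinearMap.id
  exact .of_split i r hr

end MonoidAlgebra


/-- if every map from a finite-dimensional `kG`-module into `X` factors
through a projective module, then `X` is projective. -/
theorem stmt_3 (k G : Type) [Field k] [Group G] [Fintype G]
    (p : ℕ) (hp : p.Prime) [CharP k p] (hdvd : p ∣ Fintype.card G)
    (X : Type) [AddCommGroup X] [Module (MonoidAlgebra k G) X]
    (hloc : ∀ (m : Type) [AddCommGroup m] [Module k m] [Module (MonoidAlgebra k G) m]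
      [IsScalarTower k (MonoidAlgebra k G) m], FiniteDimensional k m →
      ∀ f : m →ₗ[MonoidAlgebra k G] X, FactorsThroughProjective (MonoidAlgebra k G) f) :
    Module.Projective (MonoidAlgebra k G) X := by
  let _ := Module.compHom X (algebraMap k (MonoidAlgebra k G))
  have : IsScalarTower k (MonoidAlgebra k G) X :=
    IsScalarTower.of_compHom k (MonoidAlgebra k G) X
  refine MonoidAlgebra.projective_of_baer (k := k) fun I f => ?_
  have hI : FiniteDimensional k I :=
    inferInstanceAs (FiniteDimensional k (I.restrictScalars k))
  obtain ⟨P, hP, u, v, rfl⟩ := hloc I hI f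
  let _ := Module.compHom P (algebraMap k (MonoidAlgebra k G))
  have : IsScalarTower k (MonoidAlgebra k G) P :=
    IsScalarTower.of_compHom k (MonoidAlgebra k G) P
  obtain ⟨u', hu'⟩ := MonoidAlgebra.baer_of_projective (k := k) (G := G) (V := P) I u
  exact ⟨v ∘ₗ u', fun x hx => congrArg v (hu' x hx)⟩
end

section
/- Let k be a field of characteristic 2, G a finite group, and 0 → x →^{d₁} y →^{d₂} z → 0 a short exact sequence of kG-modules. Let Γ = G × C₂ with h the nontrivial element of C₂, and let M be the k-vector space x ⊕ y ⊕ z made into a k[Γ]-module by letting (g, e) act componentwise by g and letting (g, h) act by g∘(1 + D), where D(a, b, c) = (0, d₁(a), d₂(b)). Then M is relatively projective with respect to the subgroup G × {e} (i.e., M is isomorphic to a direct summand of the induced module k[Γ] ⊗_{k[G]} M) if and only if the short exact sequence 0 → x → y → z → 0 splits. -/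
/-- Every vector over a field of characteristic 2 is 2-torsion. -/
theorem add_self_eq_zero_of_charTwo (k : Type*) {V : Type*} [Field k] [CharP k 2]
    [AddCommGroup V] [Module k V] (v : V) : v + v = 0 := by
  rw [← two_smul k v, CharTwo.two_eq_zero, zero_smul]

/-- The sufficiency half of Higman's criterion: if the identity is the relative trace of a
`G`-endomorphism, then the representation is a direct summand of the induced representation. -/
theorem exists_section_retraction_of_trace_eq_id {k G V : Type*} [Field k] [Group G]
    [AddCommGroup V] [Module k V] (ρ : Representation k (G × Multiplicative (ZMod 2)) V)
    (θ : V →ₗ[k] V) (hθ : ∀ (g : G) (v : V), θ (ρ (g, 1) v) = ρ (g, 1) (θ v))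
    (htr : ∀ v : V, ∑ j : ZMod 2,
      ρ (1, Multiplicative.ofAdd j) (θ (ρ (1, Multiplicative.ofAdd (-j)) v)) = v) :
    ∃ (i : V →ₗ[k] (ZMod 2 → V)) (r : (ZMod 2 → V) →ₗ[k] V),
      (∀ (γ : G × Multiplicative (ZMod 2)) (v : V),
        i (ρ γ v) = fun j => ρ (γ.1, 1) (i v (j - Multiplicative.toAdd γ.2))) ∧
      (∀ (γ : G × Multiplicative (ZMod 2)) (w : ZMod 2 → V),
        r (fun j => ρ (γ.1, 1) (w (j - Multiplicative.toAdd γ.2))) = ρ γ (r w)) ∧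
      r ∘ₗ i = LinearMap.id := by
  refine ⟨LinearMap.pi fun j => ρ (1, Multiplicative.ofAdd (-j)),
    ∑ j : ZMod 2, ρ (1, Multiplicative.ofAdd j) ∘ₗ θ ∘ₗ LinearMap.proj j, ?_, ?_, ?_⟩
  · rintro ⟨g, t⟩ v
    funext j
    simp only [LinearMap.pi_apply, ← Module.End.mul_apply, ← map_mul, Prod.mk_mul_mk, one_mul,
      mul_one]
    congr 3
    apply Multiplicative.toAdd.injective
    simp only [toAdd_mul, toAdd_ofAdd]
    abel
  · rintro ⟨g, t⟩ w
    simp only [LinearMap.sum_apply, LinearMap.comp_apply, LinearMap.proj_apply, map_sum, hθ]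
    rw [← Equiv.sum_comp (Equiv.addRight (Multiplicative.toAdd t))]
    refine Finset.sum_congr rfl fun j _ => ?_
    have hmul (a b : G × Multiplicative (ZMod 2)) (v : V) : ρ a (ρ b v) = ρ (a * b) v := by
      rw [map_mul, Module.End.mul_apply]
    simp only [Equiv.coe_addRight, add_sub_cancel_right, hmul, Prod.mk_mul_mk, one_mul, mul_one,
      ofAdd_add, ofAdd_toAdd]
    rw [mul_comm]
  · ext v
    simpa using htr v

/-- An equivariant section of `d₂` determines an equivariant retraction of `d₁`. -/
theorem exists_retraction_of_section {k G X Y Z : Type*} [Field k] [Group G]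
    [AddCommGroup X] [Module k X] [AddCommGroup Y] [Module k Y]
    [AddCommGroup Z] [Module k Z]
    {ρx : Representation k G X} {ρy : Representation k G Y} {ρz : Representation k G Z}
    {d₁ : X →ₗ[k] Y} {d₂ : Y →ₗ[k] Z}
    (hd₁ : ∀ (g : G) (a : X), d₁ (ρx g a) = ρy g (d₁ a))
    (hd₂ : ∀ (g : G) (b : Y), d₂ (ρy g b) = ρz g (d₂ b))
    (hinj : Function.Injective d₁) (hexact : LinearMap.range d₁ = LinearMap.ker d₂)
    (σ : Z →ₗ[k] Y) (hσ : ∀ (g : G) (c : Z), σ (ρz g c) = ρy g (σ c))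
    (hsec : ∀ c, d₂ (σ c) = c) :
    ∃ s : Y →ₗ[k] X, (∀ (g : G) (b : Y), s (ρy g b) = ρx g (s b)) ∧
      (∀ b, d₁ (s b) = b - σ (d₂ b)) ∧ ∀ a, s (d₁ a) = a := by
  have hmem (b : Y) : ((LinearMap.id : Y →ₗ[k] Y) - σ ∘ₗ d₂) b ∈ LinearMap.range d₁ := by
    rw [hexact]
    simp [hsec]
  let s : Y →ₗ[k] X := (LinearEquiv.ofInjective d₁ hinj).symm.toLinearMap ∘ₗ
    ((LinearMap.id : Y →ₗ[k] Y) - σ ∘ₗ d₂).codRestrict (LinearMap.range d₁) hmem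
  have hs (b : Y) : d₁ (s b) = b - σ (d₂ b) :=
    congrArg Subtype.val ((LinearEquiv.ofInjective d₁ hinj).apply_symm_apply
      ⟨((LinearMap.id : Y →ₗ[k] Y) - σ ∘ₗ d₂) b, hmem b⟩)
  have hd (a : X) : d₂ (d₁ a) = 0 := by
    rw [← LinearMap.mem_ker, ← hexact]
    exact ⟨a, rfl⟩
  refine ⟨s, fun g b => hinj ?_, hs, fun a => hinj ?_⟩
  · rw [hs, hd₁, hs, hd₂, hσ, map_sub]
  · rw [hs, hd, map_zero, sub_zero]

/-- for a short exact sequence `0 → x → y → z → 0` of `kG`-modules in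
characteristic 2, the `k[G × C₂]`-module `M = x ⊕ y ⊕ z`, where `(g,e)` acts
componentwise and `(g,h)` acts by `g ∘ (1 + D)` with `D(a,b,c) = (0, d₁ a, d₂ b)`, is
relatively `G`-projective (a direct summand of the induced module of its restriction,
realized as `C₂ → M` with `(g, h^r)` acting by `(v ↦ fun j => (g,e)·v (j - r))`)
iff the sequence splits as a sequence of `kG`-modules. -/
theorem stmt_6 (k G : Type) [Field k] [CharP k 2] [Group G] [Finite G]
    (X Y Z : Type) [AddCommGroup X] [Module k X] [AddCommGroup Y] [Module k Y]
    [AddCommGroup Z] [Module k Z]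
    (ρx : Representation k G X) (ρy : Representation k G Y) (ρz : Representation k G Z)
    (d₁ : X →ₗ[k] Y) (d₂ : Y →ₗ[k] Z)
    (hd₁ : ∀ (g : G) (a : X), d₁ (ρx g a) = ρy g (d₁ a))
    (hd₂ : ∀ (g : G) (b : Y), d₂ (ρy g b) = ρz g (d₂ b))
    (hinj : Function.Injective d₁) (hsurj : Function.Surjective d₂)
    (hexact : LinearMap.range d₁ = LinearMap.ker d₂)
    (ρM : Representation k (G × Multiplicative (ZMod 2)) (X × Y × Z))
    (hM₁ : ∀ (g : G) (v : X × Y × Z),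
      ρM (g, 1) v = (ρx g v.1, ρy g v.2.1, ρz g v.2.2))
    (hM₂ : ∀ (g : G) (v : X × Y × Z),
      ρM (g, Multiplicative.ofAdd (1 : ZMod 2)) v =
        (ρx g v.1, ρy g (v.2.1 + d₁ v.1), ρz g (v.2.2 + d₂ v.2.1))) :
    (∃ (i : (X × Y × Z) →ₗ[k] (ZMod 2 → X × Y × Z))
       (r : (ZMod 2 → X × Y × Z) →ₗ[k] (X × Y × Z)),
      (∀ (γ : G × Multiplicative (ZMod 2)) (v : X × Y × Z),
        i (ρM γ v) = fun j => ρM (γ.1, 1) (i v (j - Multiplicative.toAdd γ.2))) ∧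
      (∀ (γ : G × Multiplicative (ZMod 2)) (w : ZMod 2 → X × Y × Z),
        r (fun j => ρM (γ.1, 1) (w (j - Multiplicative.toAdd γ.2))) = ρM γ (r w)) ∧
      r ∘ₗ i = LinearMap.id) ↔
    (∃ σ : Z →ₗ[k] Y, (∀ (g : G) (c : Z), σ (ρz g c) = ρy g (σ c)) ∧
      d₂ ∘ₗ σ = LinearMap.id) := by
  have hone : ∀ v : X × Y × Z, ρM (1, Multiplicative.ofAdd (1 : ZMod 2)) v =
      (v.1, v.2.1 + d₁ v.1, v.2.2 + d₂ v.2.1) := fun v => by simp [hM₂]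
  constructor
  · rintro ⟨i, r, hi, hr, hri⟩
    have hrG (g : G) (w : ZMod 2 → X × Y × Z) :
        r (fun j => ρM (g, 1) (w j)) = ρM (g, 1) (r w) := by
      simpa using hr (g, 1) w
    let θ : (X × Y × Z) →ₗ[k] (X × Y × Z) :=
      r ∘ₗ LinearMap.single k (fun _ : ZMod 2 => X × Y × Z) 0 ∘ₗ LinearMap.proj 0 ∘ₗ i
    have hθ (g : G) (v : X × Y × Z) : θ (ρM (g, 1) v) = ρM (g, 1) (θ v) := by
      simp only [θ, LinearMap.comp_apply, LinearMap.proj_apply, ← hrG, hi]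
      congr 1
      funext j
      by_cases hj : j = 0
      · subst hj
        simp
      · simp [hj]
    have htr (c : Z) : θ (0, 0, c) +
        ρM (1, Multiplicative.ofAdd (1 : ZMod 2)) (θ (0, 0, c)) = (0, 0, c) := by
      have hfix : ρM (1, Multiplicative.ofAdd (1 : ZMod 2)) (0, 0, c) = (0, 0, c) := by
        simp [hone]
      have hper : i (0, 0, c) 1 = i (0, 0, c) 0 := by
        have := congrFun (hi (1, Multiplicative.ofAdd (1 : ZMod 2)) (0, 0, c)) 1
        rw [hfix] at this
        simpa [← Prod.one_eq_mk] using this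
      have hsplit := LinearMap.congr_fun hri (0, 0, c)
      simp only [θ, LinearMap.comp_apply, LinearMap.proj_apply, ← hr, ← map_add]
      refine Eq.trans (congrArg r ?_) hsplit
      funext j
      change Pi.single (M := fun _ => X × Y × Z) 0 (i (0, 0, c) 0) j +
        ρM (1, 1) (Pi.single (M := fun _ => X × Y × Z) 0 (i (0, 0, c) 0) (j - 1)) = i (0, 0, c) j
      obtain rfl | rfl : j = 0 ∨ j = 1 := by
        revert j
        decide
      · simp [← Prod.one_eq_mk]
      · simp [← Prod.one_eq_mk, hper]
    refine ⟨LinearMap.fst k Y Z ∘ₗ LinearMap.snd k X (Y × Z) ∘ₗ θ ∘ₗ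
      LinearMap.inr k X (Y × Z) ∘ₗ LinearMap.inr k Y Z, fun g c => ?_, ?_⟩
    · have := hθ g (0, 0, c)
      rw [hM₁, hM₁] at this
      simpa using congrArg (fun v => v.2.1) this
    · ext c
      have := congrArg (fun v => v.2.2) (htr c)
      rw [hone] at this
      simpa [← add_assoc, add_self_eq_zero_of_charTwo k] using this
  · rintro ⟨σ, hσ, hsec⟩
    replace hsec (c : Z) : d₂ (σ c) = c := LinearMap.congr_fun hsec c
    obtain ⟨s, hsG, hds, hsd⟩ := exists_retraction_of_section hd₁ hd₂ hinj hexact σ hσ hsec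
    let q : (X × Y × Z) →ₗ[k] Y := LinearMap.fst k Y Z ∘ₗ LinearMap.snd k X (Y × Z)
    let p : (X × Y × Z) →ₗ[k] Z := LinearMap.snd k Y Z ∘ₗ LinearMap.snd k X (Y × Z)
    let θ : (X × Y × Z) →ₗ[k] (X × Y × Z) :=
      (LinearMap.fst k X (Y × Z) + s ∘ₗ q).prod ((σ ∘ₗ (p + d₂ ∘ₗ q)).prod 0)
    have hθ (v : X × Y × Z) : θ v = (v.1 + s v.2.1, σ (v.2.2 + d₂ v.2.1), 0) := rfl
    refine exists_section_retraction_of_trace_eq_id ρM θ (fun g v => ?_) fun v => ?_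
    · simp [hθ, hM₁, hsG, hd₂, hσ]
    · have hneg : (-1 : ZMod 2) = 1 := by decide
      have hd : d₂ (d₁ v.1) = 0 := by
        rw [← LinearMap.mem_ker, ← hexact]
        exact ⟨v.1, rfl⟩
      have hsum (f : ZMod 2 → X × Y × Z) : ∑ j, f j = f 0 + f 1 := Fin.sum_univ_two f
      have tx := add_self_eq_zero_of_charTwo k (V := X)
      have ty := add_self_eq_zero_of_charTwo k (V := Y)
      have tz := add_self_eq_zero_of_charTwo k (V := Z)
      rw [hsum, hneg]
      simp only [neg_zero, ofAdd_zero, ← Prod.one_eq_mk, map_one, Module.End.one_apply, hone, hθ,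
        map_add, map_zero, hds, hsd, hd, hsec, Prod.mk_add_mk]
      obtain ⟨a, b, c⟩ := v
      refine Prod.ext ?_ (Prod.ext ?_ ?_) <;> dsimp only
      · calc _ = a + (a + a) + (s b + s b) := by abel
          _ = a := by rw [tx, tx, add_zero, add_zero]
      · calc _ = b + (σ c + σ c) + (σ (d₂ b) + σ (d₂ b)) + (d₁ a + d₁ a) := by abel
          _ = b := by rw [ty, ty, ty, add_zero, add_zero, add_zero]
      · calc _ = c + (d₂ b + d₂ b) := by abel
          _ = c := by rw [tz, add_zero]
end

section
/- Let p be a prime, k a field of characteristic p, G a finite group, and 0 → x →^{d₁} y →^{d₂} z → 0 a short exact sequence of kG-modules. Let Γ = G × C_p with h a generator of C_p. Let M be the k-vector space x₁ ⊕ ⋯ ⊕ x_{p−1} ⊕ y ⊕ z₁ ⊕ ⋯ ⊕ z_{p−1}, where each x_i = x and each z_j = z, and let s be the k-linear 'shift' acting as the identity map x_i → x_{i+1} for 1 ≤ i ≤ p−2, as d₁ : x_{p−1} → y, as d₂ : y → z₁, as the identity map z_j → z_{j+1} for 1 ≤ j ≤ p−2, and as 0 on z_{p−1}. Make M a k[Γ]-module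 by letting (g, h^r) act as g∘(1 + s)^r. Then M is relatively projective with respect to the subgroup G × {e} (i.e., M is isomorphic to a direct summand of k[Γ] ⊗_{k[G]} M) if and only if the short exact sequence 0 → x → y → z → 0 splits. -/
section RelativeProjectivity

variable {p : ℕ} {k G V : Type} [Field k] [Group G] [AddCommGroup V] [Module k V]

/-- `V` is a direct summand of the module induced from its restriction to `G`, the induced module
being realized as `ZMod p → V`. -/
def IsSummandOfInduced (ρ : Representation k (G × Multiplicative (ZMod p)) V) : Prop :=
  ∃ (i : V →ₗ[k] (ZMod p → V)) (r : (ZMod p → V) →ₗ[k] V),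
    (∀ (γ : G × Multiplicative (ZMod p)) (v : V),
      i (ρ γ v) = fun j => ρ (γ.1, 1) (i v (j - Multiplicative.toAdd γ.2))) ∧
    (∀ (γ : G × Multiplicative (ZMod p)) (w : ZMod p → V),
      r (fun j => ρ (γ.1, 1) (w (j - Multiplicative.toAdd γ.2))) = ρ γ (r w)) ∧
    r ∘ₗ i = LinearMap.id

theorem rho_one_ofAdd_natCast (ρ : Representation k (G × Multiplicative (ZMod p)) V) (m : ℕ) :
    ρ (1, Multiplicative.ofAdd (m : ZMod p)) =
      ρ (1, Multiplicative.ofAdd (1 : ZMod p)) ^ m := by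
  rw [← map_pow]
  congr 1
  ext
  · simp
  · simp [← ofAdd_nsmul]

theorem rho_one_ofAdd [NeZero p] (ρ : Representation k (G × Multiplicative (ZMod p)) V)
    (c : ZMod p) :
    ρ (1, Multiplicative.ofAdd c) = ρ (1, Multiplicative.ofAdd (1 : ZMod p)) ^ c.val := by
  rw [← rho_one_ofAdd_natCast, ZMod.natCast_zmod_val]

/-- A relatively projective module admits a `G`-equivariant endomorphism that factors through the
`C_p`-coinvariants and lifts the identity of the coinvariants. -/
theorem IsSummandOfInduced.exists_coinvariants_section [NeZero p]
    {ρ : Representation k (G × Multiplicative (ZMod p)) V} (h : IsSummandOfInduced ρ) :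
    ∃ τ : V →ₗ[k] V, (∀ g v, τ (ρ (g, 1) v) = ρ (g, 1) (τ v)) ∧
      (∀ a v, τ (ρ (1, a) v) = τ v) ∧
      ∀ (W : Type) [AddCommGroup W] [Module k W] (π : V →ₗ[k] W),
        (∀ a v, π (ρ (1, a) v) = π v) → ∀ v, π (τ v) = π v := by
  obtain ⟨i, r, hi, hr, hri⟩ := h
  have hρ1 : ∀ v, ρ ((1 : G), (1 : Multiplicative (ZMod p))) v = v := fun v => by
    change ρ 1 v = v
    simp
  refine ⟨r ∘ₗ LinearMap.single k (fun _ : ZMod p => V) 0 ∘ₗ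
    (∑ j : ZMod p, LinearMap.proj j) ∘ₗ i, ?_, ?_, ?_⟩
  · intro g v
    simp only [LinearMap.comp_apply, LinearMap.sum_apply, LinearMap.proj_apply,
      LinearMap.single_apply]
    rw [hi, ← hr]
    congr 1
    ext j
    simp only [toAdd_one, sub_zero, ← map_sum]
    by_cases hj : j = 0
    · subst hj; simp
    · simp [hj]
  · intro a v
    simp only [LinearMap.comp_apply, LinearMap.sum_apply, LinearMap.proj_apply]
    rw [hi]
    simp only [hρ1]
    congr 2
    exact Equiv.sum_comp (Equiv.subRight (Multiplicative.toAdd a)) (i v)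
  · intro W _ _ π hπ v
    have hshift : ∀ (j : ZMod p) (m : V), π (r (Pi.single j m)) = π (r (Pi.single 0 m)) := by
      intro j m
      rw [← hπ (Multiplicative.ofAdd j) (r (Pi.single 0 m)), ← hr]
      congr 2
      ext l
      simp only [hρ1, toAdd_ofAdd]
      by_cases hl : l = j
      · subst hl; simp
      · simp [hl, sub_eq_zero]
    simp only [LinearMap.comp_apply, LinearMap.sum_apply, LinearMap.proj_apply,
      LinearMap.single_apply]
    have hv : π v = π (r (i v)) := by
      rw [← LinearMap.comp_apply r i, hri, LinearMap.id_apply]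
    rw [hv]
    conv_rhs => rw [← Finset.univ_sum_single (i v)]
    have hs : Pi.single (0 : ZMod p) (∑ j, i v j) =
        ∑ j, (Pi.single (0 : ZMod p) (i v j) : ZMod p → V) :=
      map_sum (LinearMap.single k (fun _ : ZMod p => V) 0) _ _
    rw [hs]
    simp only [map_sum, hshift]

/-- If `V` is generated over `k[C_p]` by elements `b` on which a `G`-endomorphism `θ` satisfies
`θ (s ^ m b) = 0` for `m < p - 1` and `θ (s ^ (p - 1) b) = b`, where `s = h - 1`, then `V` is
relatively projective. -/
theorem isSummandOfInduced_of_generators [Fact p.Prime]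
    (ρ : Representation k (G × Multiplicative (ZMod p)) V) (θ : V →ₗ[k] V)
    (hθ : ∀ g v, θ (ρ (g, 1) v) = ρ (g, 1) (θ v)) (B : Set V)
    (hlow : ∀ b ∈ B, ∀ m < p - 1,
      θ (((ρ (1, Multiplicative.ofAdd (1 : ZMod p)) - 1) ^ m) b) = 0)
    (htop : ∀ b ∈ B, θ (((ρ (1, Multiplicative.ofAdd (1 : ZMod p)) - 1) ^ (p - 1)) b) = b)
    (hspan : ∀ K : Submodule k V, B ⊆ K →
      (∀ v ∈ K, (ρ (1, Multiplicative.ofAdd (1 : ZMod p)) - 1) v ∈ K) → K = ⊤) :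
    IsSummandOfInduced ρ := by
  have hpow : ∀ b ∈ B, ∀ m ≤ p - 1,
      θ ((ρ (1, Multiplicative.ofAdd (1 : ZMod p)) ^ m) b) = if m = p - 1 then b else 0 := by
    intro b hb m hm
    set S := ρ (1, Multiplicative.ofAdd (1 : ZMod p)) - 1 with hS
    have hH : ρ (1, Multiplicative.ofAdd (1 : ZMod p)) = S + 1 := by simp [hS]
    rw [hH, (Commute.one_right S).add_pow]
    simp only [one_pow, mul_one, LinearMap.sum_apply, map_sum, Module.End.mul_apply,
      Module.End.natCast_apply, map_nsmul]
    rw [Finset.sum_range_succ, Finset.sum_eq_zero]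
    · split_ifs with h
      · subst h; simp [htop b hb]
      · simp [hlow b hb m (lt_of_le_of_ne hm h)]
    · intro l hl
      rw [hlow b hb l (by have := Finset.mem_range.mp hl; omega), smul_zero]
  have hmul : ∀ (g : G) (a b : Multiplicative (ZMod p)) (v : V),
      ρ (1, a) (ρ (g, b) v) = ρ (g, a * b) v := fun g a b v => by
    rw [← Module.End.mul_apply, ← map_mul, Prod.mk_mul_mk, one_mul]
  have hmul' : ∀ (g : G) (a b : Multiplicative (ZMod p)) (v : V),
      ρ (g, a) (ρ (1, b) v) = ρ (g, a * b) v := fun g a b v => by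
    rw [← Module.End.mul_apply, ← map_mul, Prod.mk_mul_mk, mul_one]
  let i : V →ₗ[k] (ZMod p → V) :=
    LinearMap.pi fun j => θ ∘ₗ ρ (1, Multiplicative.ofAdd (-j - 1))
  let r : (ZMod p → V) →ₗ[k] V :=
    ∑ j : ZMod p, ρ (1, Multiplicative.ofAdd j) ∘ₗ LinearMap.proj j
  have hi : ∀ (γ : G × Multiplicative (ZMod p)) (v : V),
      i (ρ γ v) = fun j => ρ (γ.1, 1) (i v (j - Multiplicative.toAdd γ.2)) := by
    rintro ⟨g, a⟩ v
    ext j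
    simp only [i, LinearMap.pi_apply, LinearMap.comp_apply]
    rw [← hθ, hmul, hmul', one_mul]
    congr 4
    apply Multiplicative.toAdd.injective
    simp only [toAdd_mul, toAdd_ofAdd]
    ring
  have hr : ∀ (γ : G × Multiplicative (ZMod p)) (w : ZMod p → V),
      r (fun j => ρ (γ.1, 1) (w (j - Multiplicative.toAdd γ.2))) = ρ γ (r w) := by
    rintro ⟨g, a⟩ w
    simp only [r, LinearMap.sum_apply, LinearMap.comp_apply, LinearMap.proj_apply, map_sum]
    rw [← Equiv.sum_comp (Equiv.addRight (Multiplicative.toAdd a))]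
    refine Finset.sum_congr rfl fun j _ => ?_
    simp only [Equiv.coe_addRight, add_sub_cancel_right]
    rw [hmul, hmul', mul_one]
    congr 3
    apply Multiplicative.toAdd.injective
    simp only [toAdd_mul, toAdd_ofAdd]
    ring
  have hri : ∀ γ v, r (i (ρ γ v)) = ρ γ (r (i v)) := fun γ v => by rw [hi, hr]
  have hB : ∀ b ∈ B, r (i b) = b := by
    intro b hb
    simp only [r, i, LinearMap.sum_apply, LinearMap.comp_apply, LinearMap.proj_apply,
      LinearMap.pi_apply]
    have hlt : ∀ c : ZMod p, c.val ≤ p - 1 := fun c => by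
      have := ZMod.val_lt c
      omega
    have hval : ∀ j : ZMod p, (-j - 1).val = p - 1 ↔ j = 0 := by
      intro j
      have hpos := (Fact.out : p.Prime).pos
      have hneg : ((p - 1 : ℕ) : ZMod p) = -1 := by
        rw [Nat.cast_sub hpos]; simp
      constructor
      · intro h
        have h' := congrArg (Nat.cast : ℕ → ZMod p) h
        rw [ZMod.natCast_zmod_val, hneg] at h'
        linear_combination -h'
      · rintro rfl
        rw [neg_zero, zero_sub, ← hneg, ZMod.val_natCast_of_lt (by omega)]
    simp only [rho_one_ofAdd ρ (-_ - 1), hpow b hb _ (hlt _), hval]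
    rw [Finset.sum_eq_single 0]
    · rw [if_pos rfl]
      change ρ 1 b = b
      simp
    · intro j _ hj
      simp [hj]
    · simp
  refine ⟨i, r, hi, hr, ?_⟩
  have hK := hspan (LinearMap.eqLocus (r ∘ₗ i) LinearMap.id)
    (fun b hb => hB b hb) (fun v hv => by
      have hv' : r (i v) = v := hv
      change r (i _) = _
      simp only [LinearMap.sub_apply, Module.End.one_apply, map_sub, hri, hv']
      rfl)
  exact LinearMap.ext fun v => by
    have : v ∈ LinearMap.eqLocus (r ∘ₗ i) LinearMap.id := hK ▸ Submodule.mem_top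
    exact this

end RelativeProjectivity

section Splitting

variable {k X Y Z : Type} [Field k] [AddCommGroup X] [Module k X] [AddCommGroup Y] [Module k Y]
  [AddCommGroup Z] [Module k Z]

theorem exists_linearMap_retraction_of_section {d₁ : X →ₗ[k] Y} {d₂ : Y →ₗ[k] Z}
    (hinj : Function.Injective d₁) (hexact : LinearMap.range d₁ = LinearMap.ker d₂)
    {σ : Z →ₗ[k] Y} (hσ : d₂ ∘ₗ σ = LinearMap.id) :
    ∃ κ : Y →ₗ[k] X, ∀ y, d₁ (κ y) = y - σ (d₂ y) := by
  have hmem : ∀ y, (LinearMap.id - σ ∘ₗ d₂ : Y →ₗ[k] Y) y ∈ LinearMap.range d₁ := fun y => by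
    have := LinearMap.congr_fun hσ (d₂ y)
    simp only [LinearMap.comp_apply, LinearMap.id_apply] at this
    simp [hexact, this]
  refine ⟨(LinearEquiv.ofInjective d₁ hinj).symm ∘ₗ LinearMap.codRestrict _ _ hmem, fun y => ?_⟩
  simp

/-- The image of the generator `(a, σ c)` in `X₁ ⊕ Y` under the `m`-th power of the shift. -/
def shiftOrbit (n : ℕ) (d₁ : X →ₗ[k] Y) (σ : Z →ₗ[k] Y) (m : ℕ) (a : X) (c : Z) :
    (Fin n → X) × Y × (Fin n → Z) :=
  (fun i => if (i : ℕ) = m then a else 0,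
    (if m = 0 then σ c else 0) + (if m = n then d₁ a else 0),
    fun j => if (j : ℕ) + 1 = m then c else 0)

/-- The endomorphism moving the top layer of the shift filtration to the
generators. -/
def topToGenerators {n : ℕ} (hn : 0 < n) (κ : Y →ₗ[k] X) (σ : Z →ₗ[k] Y) :
    ((Fin n → X) × Y × (Fin n → Z)) →ₗ[k] ((Fin n → X) × Y × (Fin n → Z)) where
  toFun v := (fun i => if (i : ℕ) = 0 then κ v.2.1 else 0, σ (v.2.2 ⟨n - 1, by omega⟩), 0)
  map_add' v w := by
    ext i
    · by_cases h : (i : ℕ) = 0 <;> simp [h]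
    · simp
    · simp
  map_smul' c v := by
    ext i
    · by_cases h : (i : ℕ) = 0 <;> simp [h]
    · simp
    · simp

theorem eq_top_of_shiftOrbit_mem {n : ℕ} {d₁ : X →ₗ[k] Y} {d₂ : Y →ₗ[k] Z}
    {σ : Z →ₗ[k] Y} {κ : Y →ₗ[k] X} (hκ : ∀ y, d₁ (κ y) = y - σ (d₂ y))
    (K : Submodule k ((Fin n → X) × Y × (Fin n → Z)))
    (hK : ∀ m ≤ n, ∀ a c, shiftOrbit n d₁ σ m a c ∈ K) : K = ⊤ := by
  rw [eq_top_iff]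
  rintro ⟨a, y, c⟩ -
  have hdecomp : ((a, y, c) : (Fin n → X) × Y × (Fin n → Z)) =
      (∑ i : Fin n, shiftOrbit n d₁ σ i (a i) 0) +
        (shiftOrbit n d₁ σ n (κ y) 0 + shiftOrbit n d₁ σ 0 0 (d₂ y)) +
        ∑ j : Fin n, shiftOrbit n d₁ σ (j + 1) 0 (c j) := by
    ext l
    · have hl := l.isLt.ne
      simp [shiftOrbit, Prod.fst_sum, Finset.sum_apply, hl, Fin.val_inj]
    · have h : ∀ i : Fin n, (i : ℕ) ≠ n := fun i => i.isLt.ne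
      simp [shiftOrbit, Prod.fst_sum, Prod.snd_sum, hκ, h]
    · simp [shiftOrbit, Prod.snd_sum, Finset.sum_apply, Fin.val_inj]
  rw [hdecomp]
  refine K.add_mem (K.add_mem (K.sum_mem fun i _ => hK _ i.isLt.le _ _)
    (K.add_mem (hK _ le_rfl _ _) (hK _ (Nat.zero_le _) _ _)))
    (K.sum_mem fun j _ => hK _ j.isLt _ _)

end Splitting

/-- for a short exact sequence `0 → x → y → z → 0` of `kG`-modules in
characteristic `p`, the `k[G × C_p]`-module
`M = x₁ ⊕ ⋯ ⊕ x_{p-1} ⊕ y ⊕ z₁ ⊕ ⋯ ⊕ z_{p-1}`, where `(g,e)` acts componentwise and a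
generator `h` of `C_p` acts by `1 + s` with `s` the shift described in the paper, is
relatively `G`-projective (a direct summand of the induced module of its restriction,
realized as `C_p → M` with `(g, h^r)` acting by `v ↦ fun j => (g,e)·v (j - r)`) iff the
sequence splits as a sequence of `kG`-modules. -/
theorem stmt_7 (p : ℕ) (hp : p.Prime) (k G : Type) [Field k] [CharP k p] [Group G] [Finite G]
    (X Y Z : Type) [AddCommGroup X] [Module k X] [AddCommGroup Y] [Module k Y]
    [AddCommGroup Z] [Module k Z]
    (ρx : Representation k G X) (ρy : Representation k G Y) (ρz : Representation k G Z)
    (d₁ : X →ₗ[k] Y) (d₂ : Y →ₗ[k] Z)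
    (hd₁ : ∀ (g : G) (a : X), d₁ (ρx g a) = ρy g (d₁ a))
    (hd₂ : ∀ (g : G) (b : Y), d₂ (ρy g b) = ρz g (d₂ b))
    (hinj : Function.Injective d₁) (hsurj : Function.Surjective d₂)
    (hexact : LinearMap.range d₁ = LinearMap.ker d₂)
    (ρM : Representation k (G × Multiplicative (ZMod p))
      ((Fin (p - 1) → X) × Y × (Fin (p - 1) → Z)))
    (hM₁ : ∀ (g : G) (v : (Fin (p - 1) → X) × Y × (Fin (p - 1) → Z)),
      ρM (g, 1) v = (fun i => ρx g (v.1 i), ρy g v.2.1, fun j => ρz g (v.2.2 j)))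
    (hM₂ : ∀ (v : (Fin (p - 1) → X) × Y × (Fin (p - 1) → Z)),
      ρM (1, Multiplicative.ofAdd (1 : ZMod p)) v =
        (v.1 + fun i : Fin (p - 1) =>
            if (i : ℕ) = 0 then 0
            else v.1 ⟨(i : ℕ) - 1, Nat.lt_of_le_of_lt (Nat.sub_le _ _) i.isLt⟩,
         v.2.1 + d₁ (v.1 ⟨p - 2, by have := hp.two_le; omega⟩),
         v.2.2 + fun j : Fin (p - 1) =>
            if (j : ℕ) = 0 then d₂ v.2.1
            else v.2.2 ⟨(j : ℕ) - 1, Nat.lt_of_le_of_lt (Nat.sub_le _ _) j.isLt⟩)) :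
    (∃ (i : ((Fin (p - 1) → X) × Y × (Fin (p - 1) → Z)) →ₗ[k]
          (ZMod p → (Fin (p - 1) → X) × Y × (Fin (p - 1) → Z)))
       (r : (ZMod p → (Fin (p - 1) → X) × Y × (Fin (p - 1) → Z)) →ₗ[k]
          ((Fin (p - 1) → X) × Y × (Fin (p - 1) → Z))),
      (∀ (γ : G × Multiplicative (ZMod p)) (v : (Fin (p - 1) → X) × Y × (Fin (p - 1) → Z)),
        i (ρM γ v) = fun j => ρM (γ.1, 1) (i v (j - Multiplicative.toAdd γ.2))) ∧
      (∀ (γ : G × Multiplicative (ZMod p))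
         (w : ZMod p → (Fin (p - 1) → X) × Y × (Fin (p - 1) → Z)),
        r (fun j => ρM (γ.1, 1) (w (j - Multiplicative.toAdd γ.2))) = ρM γ (r w)) ∧
      r ∘ₗ i = LinearMap.id) ↔
    (∃ σ : Z →ₗ[k] Y, (∀ (g : G) (c : Z), σ (ρz g c) = ρy g (σ c)) ∧
      d₂ ∘ₗ σ = LinearMap.id) := by
  have : Fact p.Prime := ⟨hp⟩
  have hp2 := hp.two_le
  change IsSummandOfInduced ρM ↔ _
  constructor
  · intro h
    obtain ⟨τ, hτG, hτC, hτπ⟩ := h.exists_coinvariants_section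
    have hdd : ∀ a, d₂ (d₁ a) = 0 := fun a => by
      have : d₁ a ∈ LinearMap.ker d₂ := hexact ▸ LinearMap.mem_range_self d₁ a
      exact this
    let π : ((Fin (p - 1) → X) × Y × (Fin (p - 1) → Z)) →ₗ[k] Z :=
      d₂ ∘ₗ LinearMap.fst k _ _ ∘ₗ LinearMap.snd k _ _
    have hπ1 : ∀ v, π (ρM (1, Multiplicative.ofAdd (1 : ZMod p)) v) = π v := fun v => by
      rw [hM₂]
      simp [π, hdd]
    have hπpow : ∀ (m : ℕ) v, π ((ρM (1, Multiplicative.ofAdd (1 : ZMod p)) ^ m) v) = π v := by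
      intro m
      induction m with
      | zero => simp
      | succ m ih =>
        intro v
        rw [pow_succ, Module.End.mul_apply, ih, hπ1]
    have hπ : ∀ a v, π (ρM (1, a) v) = π v := fun a v => by
      rw [← ofAdd_toAdd a, rho_one_ofAdd, hπpow]
    let ι : Y →ₗ[k] ((Fin (p - 1) → X) × Y × (Fin (p - 1) → Z)) :=
      LinearMap.inr k _ _ ∘ₗ LinearMap.inl k _ _
    let f : Y →ₗ[k] Y := LinearMap.fst k _ _ ∘ₗ LinearMap.snd k _ _ ∘ₗ τ ∘ₗ ι
    have hf : ∀ b, d₂ b = 0 → f b = 0 := by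
      intro b hb
      obtain ⟨a, rfl⟩ : b ∈ LinearMap.range d₁ := hexact ▸ hb
      let e : (Fin (p - 1) → X) × Y × (Fin (p - 1) → Z) :=
        (fun i => if (i : ℕ) = p - 2 then a else 0, 0, 0)
      have he : ρM (1, Multiplicative.ofAdd (1 : ZMod p)) e = e + ι (d₁ a) := by
        rw [hM₂]
        ext i
        · have hi := i.isLt
          simp only [e, ι, Prod.fst_add, Pi.add_apply]
          by_cases h0 : (i : ℕ) = 0
          · simp [h0]
          · have : (i : ℕ) - 1 ≠ p - 2 := by omega
            simp [h0, this]
        · simp [e, ι]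
        · simp [e, ι]
      have h0 : τ (ι (d₁ a)) = 0 := by
        have := hτC (Multiplicative.ofAdd (1 : ZMod p)) e
        rw [he, map_add] at this
        simpa using this
      simp [f, h0]
    have hfd : ∀ b, d₂ (f b) = d₂ b := fun b => hτπ Z π hπ (ι b)
    have hfG : ∀ g b, f (ρy g b) = ρy g (f b) := by
      intro g b
      have hι : ι (ρy g b) = ρM (g, 1) (ι b) := by
        rw [hM₁]
        ext i <;> simp [ι]
      simp only [f, LinearMap.comp_apply]
      rw [hι, hτG, hM₁]
      rfl
    obtain ⟨t, ht⟩ := d₂.exists_rightInverse_of_surjective (LinearMap.range_eq_top.mpr hsurj)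
    have ht' : ∀ c, d₂ (t c) = c := fun c => LinearMap.congr_fun ht c
    have hft : ∀ b, f (t (d₂ b)) = f b := fun b => by
      rw [← sub_eq_zero, ← map_sub]
      exact hf _ (by simp [ht'])
    refine ⟨f ∘ₗ t, fun g c => ?_, ?_⟩
    · simp only [LinearMap.comp_apply]
      rw [← hfG, ← hft (ρy g (t c)), hd₂, ht']
    · ext c
      simp [hfd, ht']
  · rintro ⟨σ, hσG, hσ⟩
    obtain ⟨κ, hκ⟩ := exists_linearMap_retraction_of_section hinj hexact hσ
    have hσ' : ∀ c, d₂ (σ c) = c := fun c => LinearMap.congr_fun hσ c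
    have hdd : ∀ a, d₂ (d₁ a) = 0 := fun a => by
      have : d₁ a ∈ LinearMap.ker d₂ := hexact ▸ LinearMap.mem_range_self d₁ a
      exact this
    have hκG : ∀ g y, κ (ρy g y) = ρx g (κ y) := fun g y => hinj (by
      rw [hd₁, hκ, hκ, hd₂, hσG, map_sub])
    have hκd : ∀ a, κ (d₁ a) = a := fun a => hinj (by rw [hκ, hdd]; simp)
    have hκσ : ∀ c, κ (σ c) = 0 := fun c => hinj (by rw [hκ, hσ']; simp)
    have hn : 0 < p - 1 := by omega
    have hS : ∀ m < p - 1, ∀ a c,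
        (ρM (1, Multiplicative.ofAdd (1 : ZMod p)) - 1) (shiftOrbit (p - 1) d₁ σ m a c) =
          shiftOrbit (p - 1) d₁ σ (m + 1) a c := by
      intro m hm a c
      rw [LinearMap.sub_apply, hM₂, Module.End.one_apply, sub_eq_iff_eq_add']
      ext i
      · simp only [shiftOrbit, Prod.fst_add, Pi.add_apply]
        congr 1
        split_ifs <;> first | rfl | omega
      · have h1 : (p - 2 = m) ↔ (m + 1 = p - 1) := by omega
        simp only [shiftOrbit, Prod.fst_add, Prod.snd_add, h1]
        congr 1
        split_ifs <;> first | contradiction | simp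
      · simp only [shiftOrbit, Prod.snd_add, Pi.add_apply]
        congr 1
        split_ifs <;> first | omega | simp [hσ']
    have hSpow : ∀ m ≤ p - 1, ∀ a c,
        ((ρM (1, Multiplicative.ofAdd (1 : ZMod p)) - 1) ^ m)
          (shiftOrbit (p - 1) d₁ σ 0 a c) = shiftOrbit (p - 1) d₁ σ m a c := by
      intro m
      induction m with
      | zero => simp
      | succ m ih =>
        intro hm a c
        rw [pow_succ', Module.End.mul_apply, ih (by omega), hS m (by omega)]
    refine isSummandOfInduced_of_generators ρM (topToGenerators hn κ σ) ?_
      {v | ∃ a c, v = shiftOrbit (p - 1) d₁ σ 0 a c} ?_ ?_ ?_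
    · intro g v
      rw [hM₁, hM₁]
      ext i
      · by_cases h : (i : ℕ) = 0 <;> simp [topToGenerators, h, hκG]
      · simp [topToGenerators, hσG]
      · simp [topToGenerators]
    · rintro _ ⟨a, c, rfl⟩ m hm
      rw [hSpow m hm.le]
      have h1 : p - 1 - 1 + 1 ≠ m := by omega
      ext i
      · by_cases h : m = 0 <;> simp [topToGenerators, shiftOrbit, hm.ne, h, hκσ, hn.ne]
      · simp [topToGenerators, shiftOrbit, h1]
      · simp [topToGenerators]
    · rintro _ ⟨a, c, rfl⟩
      rw [hSpow _ le_rfl]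
      have h1 : p - 1 - 1 + 1 = p - 1 := by omega
      ext i
      · simp [topToGenerators, shiftOrbit, hn.ne', hκd]
      · simp [topToGenerators, shiftOrbit, h1, hn.ne]
      · simp [topToGenerators, shiftOrbit]
    · intro K hBK hKS
      refine eq_top_of_shiftOrbit_mem hκ K fun m => ?_
      induction m with
      | zero => exact fun _ a c => hBK ⟨a, c, rfl⟩
      | succ m ih =>
        intro hm a c
        rw [← hS m (by omega)]
        exact hKS _ (ih (by omega) a c)
end

section
/- Let k be a field, G a finite group, and w a finite-dimensional kG-module. Let (m_i)_{i≥1} be a sequence of kG-modules with connecting maps s_i : m_i → m_{i+1} and colimit M, giving the exact sequence 0 → ⊕_i m_i →^{1−s} ⊕_i m_i →^{t} M → 0, where s is induced by the maps s_i and t is the canonical map to the colimit. Let x be a finite-dimensional kG-module and β : x → M a kG-homomorphism that factors through a w-projective module, and suppose β = t∘β' for some kG-homomorphism β' : x → ⊕_i m_i. Then there exists a kG-homomorphism γ : x → ⊕_i m_i such that t∘γ = 0 and β' − γ factors through a w-projective module. -/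
open CategoryTheory MonoidalCategory TensorProduct DirectSum

/-- The componentwise action of `g` on a direct sum of representations. -/
def dsAct {k G : Type} [Field k] [Group G] (m : ℕ → Type)
    [∀ i, AddCommGroup (m i)] [∀ i, Module k (m i)]
    (ρm : ∀ i, Representation k G (m i)) (g : G) :
    (⨁ i, m i) →ₗ[k] ⨁ i, m i :=
  DirectSum.toModule k ℕ _ (fun i => (DirectSum.lof k ℕ m i) ∘ₗ (ρm i g))

/-- The shift map `s` of the telescope of a sequence of modules. -/
def dsShift {k : Type} [Field k] (m : ℕ → Type)
    [∀ i, AddCommGroup (m i)] [∀ i, Module k (m i)]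
    (s : ∀ i, m i →ₗ[k] m (i + 1)) : (⨁ i, m i) →ₗ[k] ⨁ i, m i :=
  DirectSum.toModule k ℕ _ (fun i => (DirectSum.lof k ℕ m (i + 1)) ∘ₗ s i)

section Telescope

variable {k G : Type} [Field k] [Group G] {m : ℕ → Type}
  [∀ i, AddCommGroup (m i)] [∀ i, Module k (m i)]

@[simp]
lemma dsAct_lof (ρm : ∀ i, Representation k G (m i)) (g : G) (i : ℕ) (a : m i) :
    dsAct m ρm g (DirectSum.lof k ℕ m i a) = DirectSum.lof k ℕ m i (ρm i g a) := by
  simp [dsAct]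

@[simp]
lemma dsShift_lof (s : ∀ i, m i →ₗ[k] m (i + 1)) (i : ℕ) (a : m i) :
    dsShift m s (DirectSum.lof k ℕ m i a) = DirectSum.lof k ℕ m (i + 1) (s i a) := by
  simp [dsShift]

/-- The endomorphism of the telescope which pushes every summand of index `i ≤ n` forward
to index `n` and is the identity on the other summands. -/
def dsPush (s : ∀ i, m i →ₗ[k] m (i + 1)) (n : ℕ) : (⨁ i, m i) →ₗ[k] ⨁ i, m i :=
  DirectSum.toModule k ℕ _ fun i => (dsShift m s ^ (n - i)) ∘ₗ DirectSum.lof k ℕ m i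

@[simp]
lemma dsPush_lof (s : ∀ i, m i →ₗ[k] m (i + 1)) (n i : ℕ) (a : m i) :
    dsPush s n (DirectSum.lof k ℕ m i a) = (dsShift m s ^ (n - i)) (DirectSum.lof k ℕ m i a) := by
  simp [dsPush]

lemma commute_dsAct_dsShift {ρm : ∀ i, Representation k G (m i)} {s : ∀ i, m i →ₗ[k] m (i + 1)}
    (hs : ∀ (i : ℕ) (g : G) (a : m i), s i (ρm i g a) = ρm (i + 1) g (s i a)) (g : G) :
    Commute (dsAct m ρm g) (dsShift m s) := by
  refine DirectSum.linearMap_ext k fun i => LinearMap.ext fun a => ?_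
  simp [Module.End.mul_apply, hs]

lemma dsPush_dsAct {ρm : ∀ i, Representation k G (m i)} {s : ∀ i, m i →ₗ[k] m (i + 1)}
    (hs : ∀ (i : ℕ) (g : G) (a : m i), s i (ρm i g a) = ρm (i + 1) g (s i a))
    (n : ℕ) (g : G) (z : ⨁ i, m i) :
    dsPush s n (dsAct m ρm g z) = dsAct m ρm g (dsPush s n z) := by
  suffices dsPush s n ∘ₗ dsAct m ρm g = dsAct m ρm g ∘ₗ dsPush s n from
    LinearMap.congr_fun this z
  refine DirectSum.linearMap_ext k fun i => LinearMap.ext fun a => ?_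
  have h := LinearMap.congr_fun ((commute_dsAct_dsShift hs g).pow_right (n - i)).eq
    (DirectSum.lof k ℕ m i a)
  simpa [Module.End.mul_apply] using h.symm

lemma apply_dsPush {s : ∀ i, m i →ₗ[k] m (i + 1)} {M : Type} [AddCommGroup M] [Module k M]
    {t : (⨁ i, m i) →ₗ[k] M} (ht : ∀ z, t (dsShift m s z) = t z) (n : ℕ) (z : ⨁ i, m i) :
    t (dsPush s n z) = t z := by
  have hpow (j : ℕ) (y : ⨁ i, m i) : t ((dsShift m s ^ j) y) = t y := by
    induction j with
    | zero => simp
    | succ j ih => rw [pow_succ', Module.End.mul_apply, ht, ih]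
  suffices t ∘ₗ dsPush s n = t from LinearMap.congr_fun this z
  refine DirectSum.linearMap_ext k fun i => LinearMap.ext fun a => ?_
  simp [hpow]

lemma eventually_dsPush_sub_dsShift (s : ∀ i, m i →ₗ[k] m (i + 1)) (c : ⨁ i, m i) :
    ∀ᶠ n in Filter.atTop, dsPush s n (c - dsShift m s c) = 0 := by
  induction c using DirectSum.induction_on with
  | zero => simp
  | of i a =>
    filter_upwards [Filter.eventually_gt_atTop i] with n hn
    change dsPush s n (DirectSum.lof k ℕ m i a - dsShift m s (DirectSum.lof k ℕ m i a)) = 0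
    obtain ⟨j, rfl⟩ := Nat.exists_eq_add_of_lt hn
    have h₁ : i + j + 1 - i = j + 1 := by omega
    have h₂ : i + j + 1 - (i + 1) = j := by omega
    rw [map_sub, dsShift_lof, dsPush_lof, dsPush_lof, h₁, h₂, pow_succ, Module.End.mul_apply,
      dsShift_lof, sub_self]
  | add a b ha hb =>
    filter_upwards [ha, hb] with n hna hnb
    rw [map_add, add_sub_add_comm, map_add, hna, hnb, add_zero]

/-- An equivariant map from a finite-dimensional representation of a finite group to the colimit
of a sequence lifts equivariantly to the telescope. -/
lemma exists_equivariant_lift [Finite G] {ρm : ∀ i, Representation k G (m i)}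
    {s : ∀ i, m i →ₗ[k] m (i + 1)}
    (hs : ∀ (i : ℕ) (g : G) (a : m i), s i (ρm i g a) = ρm (i + 1) g (s i a))
    {M : Type} [AddCommGroup M] [Module k M] {ρM : Representation k G M}
    {t : (⨁ i, m i) →ₗ[k] M}
    (ht : ∀ (g : G) (v : ⨁ i, m i), t (dsAct m ρm g v) = ρM g (t v))
    (htsurj : Function.Surjective t)
    (hexact : LinearMap.range (LinearMap.id - dsShift m s) = LinearMap.ker t)
    {Y : Type} [AddCommGroup Y] [Module k Y] [FiniteDimensional k Y] {ρY : Representation k G Y}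
    {v : Y →ₗ[k] M} (hv : ∀ (g : G) (y : Y), v (ρY g y) = ρM g (v y)) :
    ∃ v' : Y →ₗ[k] ⨁ i, m i,
      (∀ (g : G) (y : Y), v' (ρY g y) = dsAct m ρm g (v' y)) ∧ t ∘ₗ v' = v := by
  obtain ⟨v₀, hv₀⟩ := Module.projective_lifting_property t v htsurj
  have hv₀' (y : Y) : t (v₀ y) = v y := LinearMap.congr_fun hv₀ y
  have htshift (z : ⨁ i, m i) : t (dsShift m s z) = t z := by
    have h : z - dsShift m s z ∈ LinearMap.ker t := hexact ▸ ⟨z, rfl⟩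
    rw [LinearMap.mem_ker, map_sub, sub_eq_zero] at h
    exact h.symm
  let b := Module.finBasis k Y
  have hev : ∀ᶠ n in Filter.atTop, ∀ g i,
      dsPush s n (v₀ (ρY g (b i)) - dsAct m ρm g (v₀ (b i))) = 0 := by
    refine Filter.eventually_all.2 fun g => Filter.eventually_all.2 fun i => ?_
    have h : v₀ (ρY g (b i)) - dsAct m ρm g (v₀ (b i)) ∈ LinearMap.ker t := by
      simp [ht, hv₀', hv]
    rw [← hexact] at h
    obtain ⟨c, hc⟩ := h
    rw [← hc]
    exact eventually_dsPush_sub_dsShift s c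
  obtain ⟨n, hn⟩ := hev.exists
  refine ⟨dsPush s n ∘ₗ v₀, fun g => ?_, LinearMap.ext fun y => ?_⟩
  · suffices (dsPush s n ∘ₗ v₀) ∘ₗ ρY g = dsAct m ρm g ∘ₗ dsPush s n ∘ₗ v₀ from
      LinearMap.congr_fun this
    refine b.ext fun i => ?_
    simpa [map_sub, sub_eq_zero, dsPush_dsAct hs] using hn g i
  · simp [apply_dsPush htshift, hv₀']

end Telescope

section RelProj

variable {k G : Type} [Field k] [Group G]

/-- For a finite group, a finite-dimensional subspace of a representation is contained in a
finite-dimensional subrepresentation. -/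
lemma exists_finite_subrepresentation_ge [Finite G] {V : Type} [AddCommGroup V] [Module k V]
    (ρ : Representation k G V) (W : Submodule k V) [FiniteDimensional k W] :
    ∃ σ : Subrepresentation ρ, W ≤ σ.toSubmodule ∧ FiniteDimensional k σ.toSubmodule := by
  refine ⟨⟨⨆ g, W.map (ρ g), fun g v hv => ?_⟩, ?_, ?_⟩
  · have h : (⨆ h, W.map (ρ h)) ≤ (⨆ h, W.map (ρ h)).comap (ρ g) := by
      refine iSup_le fun h => ?_
      rintro _ ⟨y, hy, rfl⟩
      exact Submodule.mem_iSup_of_mem (g * h) ⟨y, hy, by simp⟩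
    exact h hv
  · exact le_iSup_of_le 1 fun y hy => ⟨y, hy, by simp⟩
  · exact Submodule.finite_iSup _

/-- An equivariant map from a finite-dimensional representation to `w ⊗ N` factors through
`w ⊗ N'` for some finite-dimensional subrepresentation `N'` of `N`. -/
lemma exists_finite_tensor_factorization [Finite G] {W N X : Type}
    [AddCommGroup W] [Module k W] [AddCommGroup N] [Module k N] [AddCommGroup X] [Module k X]
    [FiniteDimensional k X] (ρW : Representation k G W) (ρN : Representation k G N)
    {ρX : Representation k G X} {u : X →ₗ[k] W ⊗[k] N}
    (hu : ∀ (g : G) (a : X), u (ρX g a) = ρW.tprod ρN g (u a)) :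
    ∃ σ : Subrepresentation ρN, FiniteDimensional k σ.toSubmodule ∧
      ∃ u' : X →ₗ[k] W ⊗[k] σ.toSubmodule,
        (∀ (g : G) (a : X), u' (ρX g a) = ρW.tprod σ.toRepresentation g (u' a)) ∧
        σ.toSubmodule.subtype.lTensor W ∘ₗ u' = u := by
  let b := Module.finBasis k X
  obtain ⟨N₀, _, hN₀⟩ := TensorProduct.exists_finite_submodule_right_of_setFinite
    (Set.range (u ∘ b)) (Set.finite_range _)
  obtain ⟨σ, hσ, _⟩ := exists_finite_subrepresentation_ge ρN N₀
  let j := σ.toSubmodule.subtype.lTensor W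
  have hj : Function.Injective j :=
    Module.Flat.lTensor_preserves_injective_linearMap _ σ.toSubmodule.injective_subtype
  have hjρ (g : G) (z : W ⊗[k] σ.toSubmodule) :
      j (ρW.tprod σ.toRepresentation g z) = ρW.tprod ρN g (j z) := by
    suffices j ∘ₗ ρW.tprod σ.toRepresentation g = ρW.tprod ρN g ∘ₗ j from
      LinearMap.congr_fun this z
    exact TensorProduct.ext' fun _ _ => rfl
  have hmem (i) : ∃ z, j z = u (b i) := by
    obtain ⟨z, hz⟩ := hN₀ ⟨i, rfl⟩
    refine ⟨(Submodule.inclusion hσ).lTensor W z, ?_⟩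
    rw [← LinearMap.comp_apply, ← LinearMap.lTensor_comp, Submodule.subtype_comp_inclusion]
    exact hz
  choose z hz using hmem
  have hju : j ∘ₗ b.constr k z = u := b.ext fun i => by simp [hz]
  refine ⟨σ, inferInstance, b.constr k z, fun g a => hj ?_, hju⟩
  have hju' (a : X) : j (b.constr k z a) = u a := LinearMap.congr_fun hju a
  rw [hjρ, hju', hju', hu]

/-- If the source is finite-dimensional, a map factoring through a `w`-projective module factors
through `w ⊗ N` for some finite-dimensional `N`. -/
lemma FactorsThroughRelProj.exists_finite [Finite G] {w : Rep k G} {X M : Type}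
    [AddCommGroup X] [Module k X] [FiniteDimensional k X] [AddCommGroup M] [Module k M]
    {ρX : Representation k G X} {ρM : Representation k G M} {f : X →ₗ[k] M}
    (hf : FactorsThroughRelProj w (fun g => ρX g) (fun g => ρM g) f) :
    ∃ N : Rep k G, FiniteDimensional k N ∧
      ∃ (u : X →ₗ[k] ↑(w ⊗ N)) (v : ↑(w ⊗ N) →ₗ[k] M),
        (∀ (g : G) (a : X), u (ρX g a) = (w ⊗ N).ρ g (u a)) ∧
        (∀ (g : G) (p : ↑(w ⊗ N)), v ((w ⊗ N).ρ g p) = ρM g (v p)) ∧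
        f = v ∘ₗ u := by
  obtain ⟨P, ⟨N, i, r, hir⟩, u, v, hu, hv, rfl⟩ := hf
  obtain ⟨σ, hσ, u', hu', hju⟩ := exists_finite_tensor_factorization w.ρ N.ρ
    (ρX := ρX) (u := i.hom.toLinearMap ∘ₗ u) fun g a => by
      simpa [hu] using Rep.hom_comm_apply i g (u a)
  let ι : Rep.of σ.toRepresentation ⟶ N :=
    Rep.ofHom ⟨σ.toSubmodule.subtype, fun g => LinearMap.ext fun _ => rfl⟩
  refine ⟨Rep.of σ.toRepresentation, hσ, u', v ∘ₗ (w ◁ ι ≫ r).hom.toLinearMap, hu',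
    fun g p => ?_, LinearMap.ext fun a => ?_⟩
  · have h := Rep.hom_comm_apply (w ◁ ι ≫ r) g p
    exact (congrArg v h).trans (hv g _)
  · have h₁ : (w ◁ ι).hom (u' a) = i.hom (u a) := LinearMap.congr_fun hju a
    have h₂ : r.hom (i.hom (u a)) = u a := congrArg (fun f => f.hom (u a)) hir
    change v (u a) = v (r.hom ((w ◁ ι).hom (u' a)))
    rw [h₁, h₂]

end RelProj

/-- if `β : x → M` factors through a `w`-projective module and `β = t ∘ β'`,
then `β'` may be modified by a `w`-projective factorization to a `kG`-map `γ` with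
`t ∘ γ = 0`. -/
theorem stmt_10 (k G : Type) [Field k] [Group G] [Finite G]
    (w : Rep k G) (hw : FiniteDimensional k w)
    (m : ℕ → Type) [∀ i, AddCommGroup (m i)] [∀ i, Module k (m i)]
    (ρm : ∀ i, Representation k G (m i))
    (s : ∀ i, m i →ₗ[k] m (i + 1))
    (hs : ∀ (i : ℕ) (g : G) (a : m i), s i (ρm i g a) = ρm (i + 1) g (s i a))
    (M : Type) [AddCommGroup M] [Module k M] (ρM : Representation k G M)
    (t : (⨁ i, m i) →ₗ[k] M)
    (ht : ∀ (g : G) (v : ⨁ i, m i), t (dsAct m ρm g v) = ρM g (t v))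
    (htsurj : Function.Surjective t)
    (hinj : Function.Injective ((LinearMap.id - dsShift m s : (⨁ i, m i) →ₗ[k] ⨁ i, m i)))
    (hexact : LinearMap.range (LinearMap.id - dsShift m s : (⨁ i, m i) →ₗ[k] ⨁ i, m i) = LinearMap.ker t)
    (x : Type) [AddCommGroup x] [Module k x] [FiniteDimensional k x]
    (ρx : Representation k G x)
    (β : x →ₗ[k] M) (hβ : ∀ (g : G) (a : x), β (ρx g a) = ρM g (β a))
    (hβproj : FactorsThroughRelProj w (fun g => ρx g) (fun g => ρM g) β)
    (β' : x →ₗ[k] ⨁ i, m i)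
    (hβ' : ∀ (g : G) (a : x), β' (ρx g a) = dsAct m ρm g (β' a))
    (hfact : β = t ∘ₗ β') :
    ∃ γ : x →ₗ[k] ⨁ i, m i,
      (∀ (g : G) (a : x), γ (ρx g a) = dsAct m ρm g (γ a)) ∧
      t ∘ₗ γ = 0 ∧
      FactorsThroughRelProj w (fun g => ρx g) (dsAct m ρm) (β' - γ) := by
  obtain ⟨N, _, u, v, hu, hv, rfl⟩ := hβproj.exists_finite
  have : FiniteDimensional k ↑(w ⊗ N) := inferInstanceAs (FiniteDimensional k (w.V ⊗[k] N.V))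
  obtain ⟨v', hv', rfl⟩ := exists_equivariant_lift hs ht htsurj hexact hv
  refine ⟨β' - v' ∘ₗ u, fun g a => ?_, ?_, w ⊗ N, ⟨N, 𝟙 _, 𝟙 _, Category.comp_id _⟩,
    u, v', hu, hv', sub_sub_cancel _ _⟩
  · simp only [LinearMap.sub_apply, LinearMap.comp_apply, map_sub, hβ', hu, hv']
  · rw [LinearMap.comp_sub, ← hfact, LinearMap.comp_assoc, sub_self]
end
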